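/- arXiv:1505.07780 — 3 statements merged into one kernel-verified Lean document; each statement's English description precedes it below -/
import Mathlib

section
/- For a graph G without isolated vertices, ∂Γ(G) = 2 if and only if G is a complete bipartite graph K_{n,m} with n ≥ 2 and m ≥ 1, or every connected component of G is a single edge (G is a disjoint union of isolated edges). -/
noncomputable section

open Function

/-- A proper coloring of `G` with colors in `Fin k`. -/
def IsProperColoring {V : Type} (G : SimpleGraph V) {k : ℕ} (c : V → Fin k) : Prop :=
  ∀ u v : V, G.Adj u v → c u ≠ c v

/-- A b-`k`-coloring: a surjective proper coloring in which every color class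
contains a b-vertex. -/
def IsBColoring {V : Type} (G : SimpleGraph V) {k : ℕ} (c : V → Fin k) : Prop :=
  Function.Surjective c ∧ IsProperColoring G c ∧
    ∀ i : Fin k, ∃ v : V, c v = i ∧ ∀ j : Fin k, j ≠ i → ∃ u : V, G.Adj v u ∧ c u = j

def HasBColoring {V : Type} (G : SimpleGraph V) (k : ℕ) : Prop :=
  ∃ c : V → Fin k, IsBColoring G c

/-- The b-chromatic number `φ(G)`. -/
def bChromatic {V : Type} [Fintype V] (G : SimpleGraph V) : ℕ :=
  sSup {k | HasBColoring G k}

/-- The b-relaxed number `φ_r(G)`: the maximum of `φ(H)` over induced subgraphs `H`. -/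
def bRelaxed {V : Type} [Fintype V] (G : SimpleGraph V) : ℕ :=
  sSup {k | ∃ s : Finset V, bChromatic (G.induce (↑s : Set V)) = k}

/-- A partial Grundy `k`-coloring: a surjective proper coloring in which every
color class contains a Grundy vertex. -/
def IsPartialGrundyColoring {V : Type} (G : SimpleGraph V) {k : ℕ} (c : V → Fin k) : Prop :=
  Function.Surjective c ∧ IsProperColoring G c ∧
    ∀ i : Fin k, ∃ v : V, c v = i ∧ ∀ j : Fin k, j < i → ∃ u : V, G.Adj v u ∧ c u = j

/-- The partial Grundy number `∂Γ(G)`. -/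
def partialGrundy {V : Type} [Fintype V] (G : SimpleGraph V) : ℕ :=
  sSup {k | ∃ c : V → Fin k, IsPartialGrundyColoring G c}

/-- A pG-`t`-atom structure on a graph `A`. -/
def IsPGAtom {V : Type} (A : SimpleGraph V) (t : ℕ) : Prop :=
  ∃ (D : Fin t → Finset V) (c : Fin t → V),
    (∀ v : V, ∃! i : Fin t, v ∈ D i) ∧
    (∀ i : Fin t, c i ∈ D i) ∧
    (∀ i : Fin t, ∀ u ∈ D i, ∀ v ∈ D i, ¬ A.Adj u v) ∧
    (∀ i : Fin t, (D i).card ≤ t - (i : ℕ)) ∧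
    (∀ i j : Fin t, j < i → ∃ v ∈ D j, A.Adj (c i) v)

/-- A minimal pG-`t`-atom: no proper induced subgraph is a pG-`t`-atom. -/
def IsMinPGAtom {V : Type} [Fintype V] (A : SimpleGraph V) (t : ℕ) : Prop :=
  IsPGAtom A t ∧
    ∀ s : Finset V, s ≠ Finset.univ → ¬ IsPGAtom (A.induce (↑s : Set V)) t

/-- A b-`t`-atom structure on a graph `A`. -/
def IsBAtom {V : Type} (A : SimpleGraph V) (t : ℕ) : Prop :=
  ∃ (D : Fin t → Finset V) (c : Fin t → V),
    (∀ v : V, ∃! i : Fin t, v ∈ D i) ∧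
    (∀ i : Fin t, c i ∈ D i) ∧
    (∀ i : Fin t, ∀ u ∈ D i, ∀ v ∈ D i, ¬ A.Adj u v) ∧
    (∀ i : Fin t, (D i).card ≤ t) ∧
    (∀ i j : Fin t, i ≠ j → ∃ v ∈ D j, A.Adj (c i) v)

/-- A minimal b-`t`-atom: no proper induced subgraph is a b-`t`-atom. -/
def IsMinBAtom {V : Type} [Fintype V] (A : SimpleGraph V) (t : ℕ) : Prop :=
  IsBAtom A t ∧
    ∀ s : Finset V, s ≠ Finset.univ → ¬ IsBAtom (A.induce (↑s : Set V)) t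

/-- `V(A) ∪ N(A)` for the induced subgraph of `G` on `s`. -/
def closedNbhdSet {V : Type} (G : SimpleGraph V) (s : Set V) : Set V :=
  s ∪ {v : V | v ∉ s ∧ ∃ u ∈ s, G.Adj u v}

/-- The induced subgraph of `G` on `s` is feasible (as a b-`t`-atom) in `G`:
some b-`t`-coloring of it extends to a proper coloring of the induced subgraph
on `V(A) ∪ N(A)` using only the `t` colors. -/
def IsFeasibleIn {V : Type} (G : SimpleGraph V) (s : Finset V) (t : ℕ) : Prop :=
  ∃ c : V → Fin t,
    IsBColoring (G.induce (↑s : Set V)) (fun v => c v.1) ∧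
    ∀ u v : V, u ∈ closedNbhdSet G (↑s : Set V) → v ∈ closedNbhdSet G (↑s : Set V) →
      G.Adj u v → c u ≠ c v

/-- A b-`t`-trap vertex: an induced b-`t`-atom avoiding `v`, not feasible in `G`
but feasible in `G - v`. -/
def IsVertexBTrap {V : Type} [Fintype V] [DecidableEq V] (G : SimpleGraph V) (v : V)
    (t : ℕ) : Prop :=
  ∃ s : Finset V, v ∉ s ∧ IsBAtom (G.induce (↑s : Set V)) t ∧ ¬ IsFeasibleIn G s t ∧
    IsFeasibleIn (G.induce {u : V | u ≠ v}) (s.subtype (fun u => u ≠ v)) t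

/-- A b-`t`-trap edge: an induced b-`t`-atom, not feasible in `G`
but feasible in `G - e`. -/
def IsEdgeBTrap {V : Type} (G : SimpleGraph V) (e : Sym2 V) (t : ℕ) : Prop :=
  ∃ s : Finset V, IsBAtom (G.induce (↑s : Set V)) t ∧ ¬ IsFeasibleIn G s t ∧
    IsFeasibleIn (G.deleteEdges {e}) s t

/-- The chromatic number as a natural number (least `k` admitting a surjective
proper `k`-coloring). -/
def chromaticNum {V : Type} [Fintype V] (G : SimpleGraph V) : ℕ :=
  sInf {k | ∃ c : V → Fin k, Function.Surjective c ∧ IsProperColoring G c}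

/-- `G` is b-χ-`k`-bounded: `φ(G') - χ(G') ≤ k` for every induced subgraph `G'`. -/
def IsBChiBounded {V : Type} [Fintype V] (G : SimpleGraph V) (k : ℕ) : Prop :=
  ∀ s : Finset V,
    bChromatic (G.induce (↑s : Set V)) - chromaticNum (G.induce (↑s : Set V)) ≤ k

/-- A χ-`k`-unbounded b-atom: a b-`t`-atom (for some positive `t`) with
`φ(G) - χ(G) > k`. -/
def IsChiUnboundedBAtom {V : Type} [Fintype V] (A : SimpleGraph V) (k : ℕ) : Prop :=
  k < bChromatic A - chromaticNum A ∧ ∃ t : ℕ, 1 ≤ t ∧ IsBAtom A t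

/-- A minimal χ-`k`-unbounded b-atom. -/
def IsMinChiUnboundedBAtom {V : Type} [Fintype V] (A : SimpleGraph V) (k : ℕ) : Prop :=
  IsChiUnboundedBAtom A k ∧
    ∀ s : Finset V, s ≠ Finset.univ → ¬ IsChiUnboundedBAtom (A.induce (↑s : Set V)) k

end

/-- `f` is a partial Grundy coloring (with colors in `ℕ`) of the subgraph of `G` induced on `S`. -/
def IsPartialGrundyOn {V : Type} (G : SimpleGraph V) (S : Finset V) (f : V → ℕ) : Prop :=
  (∀ u ∈ S, ∀ v ∈ S, G.Adj u v → f u ≠ f v) ∧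
    ∀ v ∈ S, ∃ w ∈ S, f w = f v ∧ ∀ j < f v, ∃ u ∈ S, G.Adj w u ∧ f u = j

/-- A partial Grundy coloring of an induced subgraph extends by one vertex, colored first-fit. -/
theorem IsPartialGrundyOn.exists_insert {V : Type} [DecidableEq V] {G : SimpleGraph V}
    {S : Finset V} {f : V → ℕ} (h : IsPartialGrundyOn G S f) {x : V} (hx : x ∉ S) :
    ∃ g : V → ℕ, IsPartialGrundyOn G (insert x S) g ∧ ∀ v ∈ S, g v = f v := by
  classical
  obtain ⟨hp, hg⟩ := h
  have hfree : ∃ n, ∀ u ∈ S, G.Adj x u → f u ≠ n := by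
    obtain ⟨n, hn⟩ := Infinite.exists_notMem_finset (S.image f)
    exact ⟨n, fun u hu _ he => hn (Finset.mem_image.2 ⟨u, hu, he⟩)⟩
  have hspec := Nat.find_spec hfree
  have hmin : ∀ j < Nat.find hfree, ∃ u ∈ S, G.Adj x u ∧ f u = j := by
    intro j hj
    simpa using Nat.find_min hfree hj
  have hne : ∀ v ∈ S, v ≠ x := fun v hv e => hx (e ▸ hv)
  have hgS : ∀ v ∈ S, Function.update f x (Nat.find hfree) v = f v :=
    fun v hv => Function.update_of_ne (hne v hv) _ _
  have hgx : Function.update f x (Nat.find hfree) x = Nat.find hfree := Function.update_self _ _ _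
  refine ⟨Function.update f x (Nat.find hfree), ⟨?_, ?_⟩, hgS⟩
  · intro u hu v hv huv
    rcases Finset.mem_insert.1 hu with rfl | huS <;>
      rcases Finset.mem_insert.1 hv with rfl | hvS
    · exact (G.loopless.irrefl _ huv).elim
    · rw [hgx, hgS v hvS]
      exact (hspec v hvS huv).symm
    · rw [hgx, hgS u huS]
      exact hspec u huS huv.symm
    · rw [hgS u huS, hgS v hvS]
      exact hp u huS v hvS huv
  · intro v hv
    rcases Finset.mem_insert.1 hv with rfl | hv
    · refine ⟨v, Finset.mem_insert_self _ _, rfl, fun j hj => ?_⟩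
      obtain ⟨u, hu, hvu, rfl⟩ := hmin j (hgx ▸ hj)
      exact ⟨u, Finset.mem_insert_of_mem hu, hvu, hgS u hu⟩
    · obtain ⟨w, hw, hwv, hj⟩ := hg v hv
      refine ⟨w, Finset.mem_insert_of_mem hw, by rw [hgS w hw, hgS v hv, hwv], fun j hlt => ?_⟩
      obtain ⟨u, hu, hwu, rfl⟩ := hj j (hgS v hv ▸ hlt)
      exact ⟨u, Finset.mem_insert_of_mem hu, hwu, hgS u hu⟩

theorem IsPartialGrundyOn.exists_univ {V : Type} [Fintype V] {G : SimpleGraph V}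
    {S : Finset V} {f : V → ℕ} (h : IsPartialGrundyOn G S f) :
    ∃ g : V → ℕ, IsPartialGrundyOn G Finset.univ g ∧ ∀ v ∈ S, g v = f v := by
  classical
  have key : ∀ T : Finset V, ∃ g : V → ℕ, IsPartialGrundyOn G (S ∪ T) g ∧ ∀ v ∈ S, g v = f v := by
    intro T
    induction T using Finset.induction_on with
    | empty => exact ⟨f, by simpa using h, fun _ _ => rfl⟩
    | insert x T _ ih =>
      obtain ⟨g, hg, hgf⟩ := ih
      rw [Finset.union_insert]
      by_cases hx : x ∈ S ∪ T
      · rw [Finset.insert_eq_of_mem hx]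
        exact ⟨g, hg, hgf⟩
      · obtain ⟨g', hg', hgg⟩ := hg.exists_insert hx
        exact ⟨g', hg', fun v hv => (hgg v (Finset.mem_union_left _ hv)).trans (hgf v hv)⟩
  obtain ⟨g, hg, hgf⟩ := key Finset.univ
  exact ⟨g, Finset.eq_univ_of_forall (s := S ∪ Finset.univ) (by simp) ▸ hg, hgf⟩

theorem le_card_of_isPartialGrundyColoring {V : Type} [Fintype V] {G : SimpleGraph V} {k : ℕ}
    {c : V → Fin k} (h : IsPartialGrundyColoring G c) : k ≤ Fintype.card V := by
  simpa using Fintype.card_le_of_surjective c h.1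

theorem bddAbove_isPartialGrundyColoring {V : Type} [Fintype V] (G : SimpleGraph V) :
    BddAbove {k | ∃ c : V → Fin k, IsPartialGrundyColoring G c} :=
  ⟨Fintype.card V, fun _ ⟨_, hc⟩ => le_card_of_isPartialGrundyColoring hc⟩

/-- A partial Grundy coloring of an induced subgraph bounds the partial Grundy number below. -/
theorem IsPartialGrundyOn.lt_partialGrundy {V : Type} [Fintype V] {G : SimpleGraph V}
    {S : Finset V} {f : V → ℕ} (h : IsPartialGrundyOn G S f) {x : V} (hx : x ∈ S) :
    f x < partialGrundy G := by
  obtain ⟨g, ⟨hp, hg⟩, hgf⟩ := h.exists_univ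
  obtain ⟨m, -, hm⟩ := Finset.exists_max_image Finset.univ g ⟨x, Finset.mem_univ x⟩
  have hlt : ∀ v, g v < g m + 1 := fun v => Nat.lt_succ_of_le (hm v (Finset.mem_univ v))
  obtain ⟨w, -, hw, hwj⟩ := hg m (Finset.mem_univ m)
  have hsurj : ∀ i < g m + 1, ∃ v, g v = i := by
    intro i hi
    rcases Nat.lt_succ_iff_lt_or_eq.1 hi with hi | rfl
    · obtain ⟨u, -, -, hu⟩ := hwj i hi
      exact ⟨u, hu⟩
    · exact ⟨m, rfl⟩
  have hmem : g m + 1 ∈ {k | ∃ c : V → Fin k, IsPartialGrundyColoring G c} := by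
    refine ⟨fun v => ⟨g v, hlt v⟩, ?_, ?_, ?_⟩
    · rintro ⟨i, hi⟩
      obtain ⟨v, hv⟩ := hsurj i hi
      exact ⟨v, Fin.ext hv⟩
    · intro u v huv he
      exact hp u (Finset.mem_univ u) v (Finset.mem_univ v) huv (Fin.ext_iff.1 he)
    · rintro ⟨i, hi⟩
      obtain ⟨v, rfl⟩ := hsurj i hi
      obtain ⟨w, -, hw, hwj⟩ := hg v (Finset.mem_univ v)
      refine ⟨w, Fin.ext hw, fun j hj => ?_⟩
      obtain ⟨u, -, hu, huj⟩ := hwj j hj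
      exact ⟨u, hu, Fin.ext huj⟩
  rw [← hgf x hx]
  exact (hlt x).trans_le (le_csSup (bddAbove_isPartialGrundyColoring G) hmem)

/-- Five vertices, not necessarily distinct, carrying the colors `2, 0, 1, 1, 0` and the edges
needed for Grundy vertices of colors `2` and `1`, force the partial Grundy number up to `3`. -/
theorem two_lt_partialGrundy {V : Type} [Fintype V] {G : SimpleGraph V} {v a b w x : V}
    (hva : G.Adj v a) (hvb : G.Adj v b) (hwx : G.Adj w x)
    (hvw : v ≠ w) (hvx : v ≠ x) (hab : a ≠ b) (haw : a ≠ w) (hbx : b ≠ x)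
    (nax : ¬ G.Adj a x) (nbw : ¬ G.Adj b w) : 2 < partialGrundy G := by
  classical
  have hfa : v ≠ a := hva.ne
  have hfb : v ≠ b := hvb.ne
  have hfw : w ≠ x := hwx.ne
  let f : V → ℕ := fun u => if u = v then 2 else if u = a ∨ u = x then 0 else 1
  have fv : f v = 2 := by simp [f]
  have fa : f a = 0 := by simp [f, hfa.symm]
  have fx : f x = 0 := by simp [f, hvx.symm]
  have fb : f b = 1 := by simp [f, hfb.symm, hab.symm, hbx]
  have fw : f w = 1 := by simp [f, hvw.symm, haw.symm, hfw]
  have hS : IsPartialGrundyOn G {v, a, b, w, x} f := by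
    have nxa : ¬ G.Adj x a := fun h => nax h.symm
    have nwb : ¬ G.Adj w b := fun h => nbw h.symm
    constructor
    · simp [fv, fa, fb, fw, fx, nax, nbw, nxa, nwb]
    · have zero : ∀ y ∈ ({v, a, b, w, x} : Finset V), f y = 0 →
          ∃ z ∈ ({v, a, b, w, x} : Finset V), f z = f y ∧
            ∀ j < f y, ∃ u ∈ ({v, a, b, w, x} : Finset V), G.Adj z u ∧ f u = j :=
        fun y hy h0 => ⟨y, hy, rfl, by simp [h0]⟩
      have one : ∀ y, f y = 1 →
          ∃ z ∈ ({v, a, b, w, x} : Finset V), f z = f y ∧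
            ∀ j < f y, ∃ u ∈ ({v, a, b, w, x} : Finset V), G.Adj z u ∧ f u = j :=
        fun y h1 => ⟨w, by simp, by rw [fw, h1], fun j hj => ⟨x, by simp, hwx, by omega⟩⟩
      intro y hy
      have hy' := hy
      simp only [Finset.mem_insert, Finset.mem_singleton] at hy'
      rcases hy' with rfl | rfl | rfl | rfl | rfl
      · refine ⟨y, hy, rfl, fun j hj => ?_⟩
        rw [fv] at hj
        interval_cases j
        · exact ⟨a, by simp, hva, fa⟩
        · exact ⟨b, by simp, hvb, fb⟩
      · exact zero _ hy fa
      · exact one _ fb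
      · exact one _ fw
      · exact zero _ hy fx
  have := hS.lt_partialGrundy (x := v) (by simp)
  rwa [fv] at this

theorem one_lt_partialGrundy {V : Type} [Fintype V] {G : SimpleGraph V} {a b : V}
    (hab : G.Adj a b) : 1 < partialGrundy G := by
  classical
  let f : V → ℕ := fun u => if u = a then 1 else 0
  have fa : f a = 1 := by simp [f]
  have fb : f b = 0 := by simp [f, hab.ne.symm]
  have hS : IsPartialGrundyOn G {a, b} f := by
    constructor
    · simp [fa, fb]
    · intro y hy
      have hy' := hy
      simp only [Finset.mem_insert, Finset.mem_singleton] at hy'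
      rcases hy' with rfl | rfl
      · exact ⟨y, hy, rfl, fun j hj => ⟨b, by simp, hab, by omega⟩⟩
      · exact ⟨y, hy, rfl, by simp [fb]⟩
  have := hS.lt_partialGrundy (x := a) (by simp)
  rwa [fa] at this

theorem exists_of_two_lt_partialGrundy {V : Type} [Fintype V] {G : SimpleGraph V}
    (h : 2 < partialGrundy G) :
    ∃ (k : ℕ) (c : V → Fin k) (v a b w x : V), IsProperColoring G c ∧
      G.Adj v a ∧ G.Adj v b ∧ G.Adj w x ∧ c a ≠ c b ∧ c b = c w ∧ c a = c x := by
  have hne : {k | ∃ c : V → Fin k, IsPartialGrundyColoring G c}.Nonempty := by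
    by_contra hne
    rw [Set.not_nonempty_iff_eq_empty] at hne
    simp [partialGrundy, hne] at h
  obtain ⟨k, hk, c, -, hp, hg⟩ : ∃ k, 2 < k ∧ ∃ c : V → Fin k, IsPartialGrundyColoring G c :=
    ⟨_, h, Nat.sSup_mem hne (bddAbove_isPartialGrundyColoring G)⟩
  obtain ⟨v, -, hv⟩ := hg ⟨2, hk⟩
  obtain ⟨w, hw, hw'⟩ := hg ⟨1, by omega⟩
  obtain ⟨a, hva, ha⟩ := hv ⟨0, by omega⟩ (by simp)
  obtain ⟨b, hvb, hb⟩ := hv ⟨1, by omega⟩ (by simp)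
  obtain ⟨x, hwx, hx⟩ := hw' ⟨0, by omega⟩ (by simp)
  exact ⟨_, c, v, a, b, w, x, hp, hva, hvb, hwx, by simp [ha, hb], by rw [hb, hw], by rw [ha, hx]⟩

theorem partialGrundy_le_two_of_existsUnique_adj {V : Type} [Fintype V] {G : SimpleGraph V}
    (h : ∀ v : V, ∃! u : V, G.Adj v u) : partialGrundy G ≤ 2 := by
  by_contra! hlt
  obtain ⟨k, c, v, a, b, w, x, -, hva, hvb, -, hab, -⟩ := exists_of_two_lt_partialGrundy hlt
  exact hab (congrArg c ((h v).unique hva hvb))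

theorem partialGrundy_le_two_of_iso {V α β : Type} [Fintype V] {G : SimpleGraph V}
    (φ : G ≃g completeBipartiteGraph α β) : partialGrundy G ≤ 2 := by
  by_contra! hlt
  obtain ⟨k, c, v, a, b, w, x, hp, hva, hvb, hwx, -, hbw, hax⟩ :=
    exists_of_two_lt_partialGrundy hlt
  have nbw : ¬ G.Adj b w := fun h => hp _ _ h hbw
  have nax : ¬ G.Adj a x := fun h => hp _ _ h hax
  rw [← φ.map_adj_iff] at hva hvb hwx nbw nax
  simp only [completeBipartiteGraph_adj] at hva hvb hwx nbw nax
  cases hv : φ v <;> cases ha : φ a <;> cases hb : φ b <;> cases hw : φ w <;>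
    cases hx : φ x <;> simp_all

/-- A graph whose adjacency means that exactly one endpoint satisfies `P` is complete bipartite. -/
theorem nonempty_iso_completeBipartiteGraph {V : Type} [Fintype V] {G : SimpleGraph V}
    (P : V → Prop) [DecidablePred P]
    (h : ∀ u v, G.Adj u v ↔ (P u ∧ ¬ P v ∨ ¬ P u ∧ P v)) :
    Nonempty (G ≃g completeBipartiteGraph (Fin (Fintype.card {v // P v}))
      (Fin (Fintype.card {v // ¬ P v}))) := by
  let e := (Equiv.sumCompl P).symm.trans
    (Equiv.sumCongr (Fintype.equivFin {v // P v}) (Fintype.equivFin {v // ¬ P v}))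
  have hl : ∀ v, (e v).isLeft ↔ P v := by
    intro v
    by_cases hv : P v <;> simp [e, hv]
  have hr : ∀ v, (e v).isRight ↔ ¬ P v := by
    intro v
    by_cases hv : P v <;> simp [e, hv]
  exact ⟨⟨e, by intro u v; rw [completeBipartiteGraph_adj, hl, hl, hr, hr, h]⟩⟩

theorem exists_iso_of_partialGrundy_le_two {V : Type} [Fintype V] {G : SimpleGraph V}
    (hiso : ∀ v : V, ∃ u : V, G.Adj v u) (h : partialGrundy G ≤ 2) {v a b : V}
    (hva : G.Adj v a) (hvb : G.Adj v b) (hab : a ≠ b) :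
    ∃ n m : ℕ, 2 ≤ n ∧ 1 ≤ m ∧ Nonempty (G ≃g completeBipartiteGraph (Fin n) (Fin m)) := by
  classical
  have triangle : ∀ p q r, G.Adj p q → G.Adj p r → ¬ G.Adj q r := fun p q r hpq hpr hqr =>
    h.not_gt <| two_lt_partialGrundy hpq hpr hqr.symm hpr.ne hpq.ne hqr.ne hqr.ne hqr.ne'
      (G.loopless.irrefl q) (G.loopless.irrefl r)
  have path : ∀ p q r s, G.Adj p q → G.Adj q r → G.Adj r s → p ≠ r → q ≠ s → G.Adj p s := by
    intro p q r s hpq hqr hrs hpr hqs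
    by_contra hps
    exact h.not_gt <| two_lt_partialGrundy hrs hqr.symm hpq.symm hqr.ne' hpr.symm hqs.symm
      hqs.symm hpq.ne' (fun h => hps h.symm) (G.loopless.irrefl q)
  have indep : ∀ x y, ¬ G.Adj v x → ¬ G.Adj v y → ¬ G.Adj x y := by
    intro x y hvx hvy hxy
    have hx : v ≠ x := fun e => hvy (e ▸ hxy)
    have hy : v ≠ y := fun e => hvx (e ▸ hxy.symm)
    have hne : ∀ {z t}, G.Adj v z → ¬ G.Adj v t → z ≠ t := fun hz ht e => ht (e ▸ hz)
    refine h.not_gt <| two_lt_partialGrundy hva hvb hxy hx hy hab (hne hva hvx) (hne hvb hvy) ?_ ?_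
    · exact fun hay => hvx (path _ _ _ _ hva hay hxy.symm hy (hne hva hvx))
    · exact fun hbx => hvy (path _ _ _ _ hvb hbx hxy hx (hne hvb hvy))
  have full : ∀ x y, G.Adj v x → ¬ G.Adj v y → G.Adj x y := by
    intro x y hvx hvy
    by_contra hxy
    obtain ⟨z, hyz⟩ := hiso y
    have hvz : G.Adj v z := by
      by_contra hvz
      exact indep _ _ hvy hvz hyz
    have hyv : y ≠ v := by
      rintro rfl
      exact hxy hvx.symm
    have hzx : z ≠ x := by
      rintro rfl
      exact hxy hyz.symm
    exact hxy (path _ _ _ _ hyz hvz.symm hvx hyv hzx).symm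
  refine ⟨_, _, ?_, ?_, nonempty_iso_completeBipartiteGraph (fun u => G.Adj v u) fun x y => ?_⟩
  · exact Fintype.one_lt_card_iff.2 ⟨⟨a, hva⟩, ⟨b, hvb⟩, fun e => hab (congrArg Subtype.val e)⟩
  · exact Fintype.card_pos_iff.2 ⟨⟨v, G.loopless.irrefl v⟩⟩
  · by_cases hx : G.Adj v x <;> by_cases hy : G.Adj v y
    · simp [hx, hy, triangle v x y hx hy]
    · simp [hx, hy, full x y hx hy]
    · simp [hx, hy, (full y x hy hx).symm]
    · simp [hx, hy, indep x y hx hy]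


/-- for G without isolated vertices, ∂Γ(G) = 2 iff G ≅ K_{n,m} with
n ≥ 2, m ≥ 1, or every connected component of G is a single edge. -/
theorem partialGrundy_eq_two_iff {V : Type} [Fintype V] [Nonempty V] (G : SimpleGraph V)
    (hiso : ∀ v : V, ∃ u : V, G.Adj v u) :
    partialGrundy G = 2 ↔
      ((∃ n m : ℕ, 2 ≤ n ∧ 1 ≤ m ∧
          Nonempty (G ≃g completeBipartiteGraph (Fin n) (Fin m))) ∨
        (∀ v : V, ∃! u : V, G.Adj v u)) := by
  have hlow : 1 < partialGrundy G := by
    obtain ⟨u, hu⟩ := hiso (Classical.arbitrary V)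
    exact one_lt_partialGrundy hu
  constructor
  · intro h
    by_cases hm : ∀ v : V, ∃! u : V, G.Adj v u
    · exact Or.inr hm
    · left
      push Not at hm
      obtain ⟨v, hv⟩ := hm
      obtain ⟨a, ha⟩ := hiso v
      have hb : ∃ b, G.Adj v b ∧ a ≠ b := by
        by_contra! hb
        exact hv ⟨a, ha, fun b hvb => (hb b hvb).symm⟩
      obtain ⟨b, hvb, hab⟩ := hb
      exact exists_iso_of_partialGrundy_le_two hiso h.le ha hvb hab
  · rintro (⟨n, m, -, -, ⟨φ⟩⟩ | hm)
    · exact le_antisymm (partialGrundy_le_two_of_iso φ) hlow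
    · exact le_antisymm (partialGrundy_le_two_of_existsUnique_adj hm) hlow
end

section
/- Let G be a graph and t a positive integer. If the b-chromatic number satisfies φ(G) ≥ t, then G contains an induced subgraph that is a minimal b-t-atom. -/
theorem IsBAtom.of_iso {V W : Type} {A : SimpleGraph V} {B : SimpleGraph W} {t : ℕ}
    (e : A ≃g B) (h : IsBAtom A t) : IsBAtom B t := by
  obtain ⟨D, c, hpart, hc, hind, hcard, hadj⟩ := h
  have mem (w : W) (i : Fin t) : w ∈ (D i).map e.toEquiv.toEmbedding ↔ e.symm w ∈ D i :=
    Finset.mem_map_equiv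
  refine ⟨fun i => (D i).map e.toEquiv.toEmbedding, fun i => e (c i), ?_, ?_, ?_, ?_, ?_⟩
  · intro w
    simpa only [mem] using hpart (e.symm w)
  · intro i
    simpa only [mem, RelIso.symm_apply_apply] using hc i
  · intro i u hu v hv huv
    exact hind i _ ((mem u i).1 hu) _ ((mem v i).1 hv) (e.symm.map_adj_iff.2 huv)
  · intro i
    simpa only [Finset.card_map] using hcard i
  · intro i j hij
    obtain ⟨v, hv, hcv⟩ := hadj i j hij
    exact ⟨e v, (mem _ _).2 (by simpa using hv), e.map_adj_iff.2 hcv⟩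

/-- An induced subgraph of an induced subgraph of `G` is an induced subgraph of `G`. -/
def induceInduceIso {V : Type} (G : SimpleGraph V) (s : Finset V)
    (r : Finset (↑s : Set V)) :
    (G.induce (↑s : Set V)).induce (↑r : Set (↑s : Set V)) ≃g
      G.induce (↑(r.map (Function.Embedding.subtype (· ∈ (↑s : Set V)))) : Set V) where
  toFun x := ⟨x.1.1, by simp⟩
  invFun y := ⟨⟨y.1, by
    obtain ⟨x, -, hx⟩ := Finset.mem_map.1 (Finset.mem_coe.1 y.2)
    exact hx ▸ x.2⟩, by
    obtain ⟨x, hxr, hx⟩ := Finset.mem_map.1 (Finset.mem_coe.1 y.2)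
    have : x = ⟨y.1, hx ▸ x.2⟩ := Subtype.ext hx
    exact Finset.mem_coe.2 (this ▸ hxr)⟩
  left_inv _ := rfl
  right_inv _ := rfl
  map_rel_iff' := Iff.rfl

theorem exists_isMinBAtom_of_isBAtom {V : Type} {G : SimpleGraph V} {t : ℕ} {s : Finset V}
    (hs : IsBAtom (G.induce (↑s : Set V)) t) :
    ∃ s : Finset V, IsMinBAtom (G.induce (↑s : Set V)) t := by
  obtain ⟨m, hm, hmin⟩ := WellFounded.has_min (InvImage.wf (Finset.card (α := V)) wellFounded_lt)
    {s : Finset V | IsBAtom (G.induce (↑s : Set V)) t} ⟨s, hs⟩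
  refine ⟨m, hm, fun r hr hatom => hmin _ (hatom.of_iso (induceInduceIso G m r)) ?_⟩
  obtain ⟨x, hx⟩ := not_forall.1 (mt Finset.eq_univ_iff_forall.2 hr)
  simpa [InvImage] using Finset.card_lt_univ_of_notMem hx

theorem hasBColoring_bChromatic {V : Type} [Fintype V] {G : SimpleGraph V}
    (h : 0 < bChromatic G) : HasBColoring G (bChromatic G) := by
  refine Nat.sSup_mem (s := {k | HasBColoring G k}) ?_ ⟨Fintype.card V, ?_⟩
  · by_contra hne
    rw [bChromatic, Set.not_nonempty_iff_eq_empty.1 hne] at h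
    simp at h
  · rintro k ⟨c, hc, -⟩
    simpa using Fintype.card_le_of_surjective c hc

theorem HasBColoring.exists_isBAtom {V : Type} {G : SimpleGraph V} {k t : ℕ} (htk : t ≤ k)
    (h : HasBColoring G k) : ∃ s : Finset V, IsBAtom (G.induce (↑s : Set V)) t := by
  classical
  obtain ⟨c, -, hproper, hb⟩ := h
  choose b hbc hbadj using hb
  let color : Fin t → Fin k := Fin.castLE htk
  have hinj : Function.Injective color := Fin.castLE_injective htk
  have hex (i j : Fin t) : ∃ u, c u = color j ∧ (i = j → u = b (color i)) ∧
      (i ≠ j → G.Adj (b (color i)) u) := by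
    by_cases hij : i = j
    · subst hij
      exact ⟨b (color i), hbc _, fun _ => rfl, fun h => absurd rfl h⟩
    · obtain ⟨u, hu, huc⟩ := hbadj (color i) (color j) (hinj.ne (Ne.symm hij))
      exact ⟨u, huc, fun h => absurd h hij, fun _ => hu⟩
  choose u huc hdiag huadj using hex
  let s : Finset V := Finset.univ.image fun p : Fin t × Fin t => u p.1 p.2
  have hus (i j : Fin t) : u i j ∈ s := Finset.mem_image_of_mem _ (Finset.mem_univ (i, j))
  refine ⟨s, fun j => Finset.univ.filter fun v => c v.1 = color j,
    fun i => ⟨u i i, hus i i⟩, ?_, ?_, ?_, ?_, ?_⟩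
  · rintro ⟨v, hv⟩
    obtain ⟨⟨i, j⟩, -, rfl⟩ := Finset.mem_image.1 (Finset.mem_coe.1 hv)
    refine ⟨j, by simp [huc], fun l hl => ?_⟩
    exact hinj ((Finset.mem_filter.1 hl).2.symm.trans (huc i j))
  · intro i
    simp [huc]
  · intro i x hx y hy hxy
    exact hproper _ _ hxy
      ((Finset.mem_filter.1 hx).2.trans (Finset.mem_filter.1 hy).2.symm)
  · intro j
    have hsub : (Finset.univ.filter fun v : (↑s : Set V) => c v.1 = color j) ⊆
        Finset.univ.image fun i => ⟨u i j, hus i j⟩ := by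
      rintro ⟨v, hv⟩ hvj
      obtain ⟨⟨i, l⟩, -, rfl⟩ := Finset.mem_image.1 (Finset.mem_coe.1 hv)
      obtain rfl : l = j := hinj ((huc i l).symm.trans (Finset.mem_filter.1 hvj).2)
      exact Finset.mem_image_of_mem _ (Finset.mem_univ i)
    simpa using (Finset.card_le_card hsub).trans Finset.card_image_le
  · intro i j hij
    refine ⟨⟨u i j, hus i j⟩, by simp [huc], ?_⟩
    simpa [hdiag i i rfl] using huadj i j hij

/-- if φ(G) ≥ t then G contains an induced minimal b-t-atom. -/
theorem exists_minBAtom_of_bChromatic_ge {V : Type} [Fintype V] (G : SimpleGraph V)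
    (t : ℕ) (ht : 1 ≤ t) (h : t ≤ bChromatic G) :
    ∃ s : Finset V, IsMinBAtom (G.induce (↑s : Set V)) t := by
  obtain ⟨s, hs⟩ := (hasBColoring_bChromatic (ht.trans h)).exists_isBAtom h
  exact exists_isMinBAtom_of_isBAtom hs
end

section
/- Let G be a graph with at least 2 vertices. Then φ_r(G−v) = φ_r(G) + ⌊|V(G)|/2⌋ − 2 holds for every vertex v of G if and only if exactly one of the following conditions is true: (i) G is isomorphic to the path P_2 (a single edge) or to the cycle C_3; (ii) G has no edges and 4 ≤ |V(G)| ≤ 5; (iii) 4 ≤ |V(G)| ≤ 5, G contains two disjoint edges, and G contains no induced b-3-atom. -/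
/-- A b-`k`-coloring of some induced subgraph of `G`, with `none` marking the deleted vertices. -/
def IsPartialBColoring {V : Type} (G : SimpleGraph V) {k : ℕ} (f : V → Option (Fin k)) : Prop :=
  (∀ u v : V, G.Adj u v → f u ≠ none → f u ≠ f v) ∧
    ∀ i : Fin k, ∃ v : V, f v = some i ∧
      ∀ j : Fin k, j ≠ i → ∃ u : V, G.Adj v u ∧ f u = some j

theorem IsPartialBColoring.le_card {V : Type} [Fintype V] {G : SimpleGraph V} {k : ℕ}
    {f : V → Option (Fin k)} (hf : IsPartialBColoring G f) : k ≤ Fintype.card V := by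
  choose g hg _ using hf.2
  have hinj : Function.Injective g := fun i j h => by
    have := hg i
    rw [h, hg j] at this
    exact (Option.some.inj this).symm
  simpa using Fintype.card_le_of_injective g hinj

theorem IsPartialBColoring.exists_of_le {V : Type} {G : SimpleGraph V} {k l : ℕ}
    {f : V → Option (Fin k)} (hf : IsPartialBColoring G f) (hl : l ≤ k) :
    ∃ f' : V → Option (Fin l), IsPartialBColoring G f' := by
  let t : Fin k → Option (Fin l) := fun i => if h : (i : ℕ) < l then some ⟨i, h⟩ else none
  have ht : ∀ i : Fin l, t (Fin.castLE hl i) = some i := fun i => by simp [t]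
  have htinj : ∀ a b, t a ≠ none → t a = t b → a = b := by
    intro a b h1 h2
    by_cases ha : (a : ℕ) < l <;> by_cases hb : (b : ℕ) < l <;> simp_all [t, Fin.ext_iff]
  refine ⟨fun v => (f v).bind t, ?_, ?_⟩
  · intro u v huv hu heq
    cases hfu : f u with
    | none => simp [hfu] at hu
    | some a =>
      cases hfv : f v with
      | none => simp_all
      | some b =>
        simp only [hfu, hfv, Option.bind_some] at hu heq
        exact hf.1 u v huv (by simp [hfu]) (by rw [hfu, hfv, htinj a b hu heq])
  · intro i
    obtain ⟨v, hv, hb⟩ := hf.2 (Fin.castLE hl i)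
    refine ⟨v, by simp [hv, ht], fun j hj => ?_⟩
    obtain ⟨u, hu, hc⟩ := hb (Fin.castLE hl j) (by simpa [Fin.ext_iff] using hj)
    exact ⟨u, hu, by simp [hc, ht]⟩

theorem HasBColoring.exists_isPartialBColoring {V : Type} {G : SimpleGraph V} {s : Set V} {k : ℕ}
    (h : HasBColoring (G.induce s) k) :
    ∃ f : V → Option (Fin k), IsPartialBColoring G f := by
  classical
  obtain ⟨c, -, hc, hb⟩ := h
  refine ⟨fun v => if hv : v ∈ s then some (c ⟨v, hv⟩) else none, ?_, ?_⟩
  · intro u v huv hu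
    by_cases hus : u ∈ s
    · by_cases hvs : v ∈ s
      · simpa [hus, hvs] using hc ⟨u, hus⟩ ⟨v, hvs⟩ huv
      · simp [hus, hvs]
    · simp [hus] at hu
  · intro i
    obtain ⟨v, hv, hb⟩ := hb i
    refine ⟨v, by simp [hv], fun j hj => ?_⟩
    obtain ⟨u, hu, hc⟩ := hb j hj
    exact ⟨u, hu, by simp [hc]⟩

theorem IsPartialBColoring.hasBColoring {V : Type} {G : SimpleGraph V} {k : ℕ}
    {f : V → Option (Fin k)} (hf : IsPartialBColoring G f) {s : Set V}
    (hs : ∀ v, v ∈ s ↔ f v ≠ none) : HasBColoring (G.induce s) k := by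
  have hsome : ∀ v : s, ∃ i, f v = some i := fun v =>
    Option.ne_none_iff_exists'.1 ((hs v).1 v.2)
  choose c hc using hsome
  have hcol : ∀ v i (h : f v = some i), ∃ hv : v ∈ s, c ⟨v, hv⟩ = i := fun v i h => by
    have hv : v ∈ s := (hs v).2 (by simp [h])
    refine ⟨hv, ?_⟩
    have := hc ⟨v, hv⟩
    simpa [h] using this.symm
  refine ⟨c, ?_, ?_, ?_⟩
  · intro i
    obtain ⟨v, hv, -⟩ := hf.2 i
    obtain ⟨h, h'⟩ := hcol v i hv
    exact ⟨_, h'⟩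
  · intro u v huv h
    exact hf.1 u v huv (by simp [hc]) (by rw [hc, hc, h])
  · intro i
    obtain ⟨v, hv, hb⟩ := hf.2 i
    obtain ⟨h, h'⟩ := hcol v i hv
    refine ⟨_, h', fun j hj => ?_⟩
    obtain ⟨u, hu, hc⟩ := hb j hj
    obtain ⟨hu', hcu⟩ := hcol u j hc
    exact ⟨⟨u, hu'⟩, hu, hcu⟩

theorem HasBColoring.le_card {V : Type} [Fintype V] {G : SimpleGraph V} {k : ℕ}
    (h : HasBColoring G k) : k ≤ Fintype.card V := by
  obtain ⟨c, hc, -⟩ := h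
  simpa using Fintype.card_le_of_surjective c hc

theorem bddAbove_hasBColoring {V : Type} [Fintype V] (G : SimpleGraph V) :
    BddAbove {k | HasBColoring G k} :=
  ⟨Fintype.card V, fun _ h => HasBColoring.le_card h⟩

theorem bddAbove_bChromatic_induce {V : Type} [Fintype V] (G : SimpleGraph V) :
    BddAbove {k | ∃ s : Finset V, bChromatic (G.induce (↑s : Set V)) = k} := by
  have : {k | ∃ s : Finset V, bChromatic (G.induce (↑s : Set V)) = k} =
      Set.range fun s : Finset V => bChromatic (G.induce (↑s : Set V)) := rfl
  rw [this]
  exact (Set.finite_range _).bddAbove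

theorem le_bRelaxed_iff {V : Type} [Fintype V] (G : SimpleGraph V) (k : ℕ) :
    k ≤ bRelaxed G ↔ ∃ f : V → Option (Fin k), IsPartialBColoring G f := by
  classical
  constructor
  · intro hk
    suffices h : ∃ f : V → Option (Fin (bRelaxed G)), IsPartialBColoring G f from
      h.elim fun f hf => hf.exists_of_le hk
    obtain ⟨s, hs⟩ : bRelaxed G ∈ {k | ∃ s : Finset V, bChromatic (G.induce (↑s : Set V)) = k} :=
      Nat.sSup_mem ⟨_, ∅, rfl⟩ (bddAbove_bChromatic_induce G)
    rw [← hs]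
    by_cases hne : {k | HasBColoring (G.induce (↑s : Set V)) k}.Nonempty
    · exact HasBColoring.exists_isPartialBColoring (Nat.sSup_mem hne (bddAbove_hasBColoring _))
    · have h0 : bChromatic (G.induce (↑s : Set V)) = 0 := by
        rw [bChromatic, Set.not_nonempty_iff_eq_empty.1 hne, csSup_empty, bot_eq_zero]
      rw [h0]
      exact ⟨fun _ => none, fun _ _ _ h => absurd rfl h, fun i => i.elim0⟩
  · rintro ⟨f, hf⟩
    let s : Finset V := Finset.univ.filter fun v => f v ≠ none
    have hb : HasBColoring (G.induce (↑s : Set V)) k := hf.hasBColoring (by simp [s])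
    exact (le_csSup (bddAbove_hasBColoring _) hb).trans
      (le_csSup (bddAbove_bChromatic_induce G) ⟨s, rfl⟩)

theorem bRelaxed_le_card {V : Type} [Fintype V] (G : SimpleGraph V) :
    bRelaxed G ≤ Fintype.card V := by
  obtain ⟨f, hf⟩ := (le_bRelaxed_iff G _).1 le_rfl
  exact hf.le_card

theorem bRelaxed_induce_le {V : Type} [Fintype V] (G : SimpleGraph V) (s : Set V) [Fintype s] :
    bRelaxed (G.induce s) ≤ bRelaxed G := by
  obtain ⟨f, hf⟩ := (le_bRelaxed_iff (G.induce s) _).1 le_rfl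
  rw [le_bRelaxed_iff]
  classical
  refine ⟨fun v => if hv : v ∈ s then f ⟨v, hv⟩ else none, ?_, ?_⟩
  · intro u v huv hu
    by_cases hus : u ∈ s
    · by_cases hvs : v ∈ s
      · simp only [hus, hvs, dite_true] at hu ⊢
        exact hf.1 ⟨u, hus⟩ ⟨v, hvs⟩ huv hu
      · simpa [hus, hvs] using hu
    · simp [hus] at hu
  · intro i
    obtain ⟨v, hv, hb⟩ := hf.2 i
    refine ⟨v, by simp [hv], fun j hj => ?_⟩
    obtain ⟨u, hu, hc⟩ := hb j hj
    exact ⟨u, hu, by simp [hc]⟩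

theorem le_bRelaxed_of_pairwise_adj {V : Type} [Fintype V] {G : SimpleGraph V} {k : ℕ}
    (g : Fin k → V) (hg : Pairwise fun i j => G.Adj (g i) (g j)) : k ≤ bRelaxed G := by
  classical
  have hinj : Function.Injective g := fun i j h => by
    by_contra hij
    exact (hg hij).ne h
  rw [le_bRelaxed_iff]
  refine ⟨Function.partialInv g, ?_, ?_⟩
  · intro u v huv hu heq
    obtain ⟨i, hi⟩ := Option.ne_none_iff_exists'.1 hu
    have hu' := (hinj.isPartialInv i u).1 hi
    have hv' := (hinj.isPartialInv i v).1 (heq ▸ hi)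
    exact huv.ne (hu'.symm.trans hv')
  · intro i
    exact ⟨g i, Function.partialInv_left hinj i, fun j hj =>
      ⟨g j, hg hj.symm, Function.partialInv_left hinj j⟩⟩

/-- With at most one spare vertex, the b-vertices of a b-coloring form a clique. -/
theorem exists_pairwise_adj_of_le_bRelaxed {V : Type} [Fintype V] {G : SimpleGraph V} {k : ℕ}
    (hk : k ≤ bRelaxed G) (hV : Fintype.card V ≤ k + 1) :
    ∃ g : Fin k → V, Function.Injective g ∧ Pairwise fun i j => G.Adj (g i) (g j) := by
  classical
  obtain ⟨f, -, hf⟩ := (le_bRelaxed_iff G k).1 hk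
  choose g hg hb using hf
  have hinj : Function.Injective g := fun i j h => by
    have := hg i
    rw [h, hg j] at this
    exact (Option.some.inj this).symm
  refine ⟨g, hinj, fun i j hij => ?_⟩
  by_contra hadj
  obtain ⟨u, hu, hfu⟩ := hb i j hij.symm
  obtain ⟨w, hw, hfw⟩ := hb j i hij
  have hu' : u ∉ Finset.univ.image g := by
    simp only [Finset.mem_image, Finset.mem_univ, true_and, not_exists]
    rintro l rfl
    rw [hg l] at hfu
    rw [Option.some.inj hfu] at hu
    exact hadj hu
  have hw' : w ∉ Finset.univ.image g := by
    simp only [Finset.mem_image, Finset.mem_univ, true_and, not_exists]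
    rintro l rfl
    rw [hg l] at hfw
    rw [Option.some.inj hfw] at hw
    exact hadj hw.symm
  have huw : u ≠ w := by
    rintro rfl
    rw [hfu] at hfw
    exact hij (Option.some.inj hfw).symm
  have hcard : (insert u (insert w (Finset.univ.image g))).card = k + 2 := by
    rw [Finset.card_insert_of_notMem (by simp only [Finset.mem_insert, not_or]; exact ⟨huw, hu'⟩),
      Finset.card_insert_of_notMem hw', Finset.card_image_of_injective _ hinj]
    simp
  have := Finset.card_le_univ (insert u (insert w (Finset.univ.image g)))
  omega

theorem one_le_bRelaxed {V : Type} [Fintype V] [Nonempty V] (G : SimpleGraph V) :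
    1 ≤ bRelaxed G :=
  le_bRelaxed_of_pairwise_adj (fun _ => Classical.arbitrary V)
    fun i j h => absurd (Subsingleton.elim i j) h

theorem two_le_bRelaxed_iff {V : Type} [Fintype V] (G : SimpleGraph V) :
    2 ≤ bRelaxed G ↔ ∃ u w, G.Adj u w := by
  constructor
  · intro h
    obtain ⟨f, -, hf⟩ := (le_bRelaxed_iff G 2).1 h
    obtain ⟨v, -, hv⟩ := hf 0
    obtain ⟨u, hu, -⟩ := hv 1 (by decide)
    exact ⟨v, u, hu⟩
  · rintro ⟨u, w, h⟩
    refine le_bRelaxed_of_pairwise_adj ![u, w] ?_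
    intro i j hij
    fin_cases i <;> fin_cases j <;> simp_all [G.adj_comm]

theorem eq_top_of_card_le_bRelaxed {V : Type} [Fintype V] {G : SimpleGraph V}
    (h : Fintype.card V ≤ bRelaxed G) : G = ⊤ := by
  obtain ⟨g, hinj, hg⟩ := exists_pairwise_adj_of_le_bRelaxed h (Nat.le_succ _)
  have hbij := (Fintype.bijective_iff_injective_and_card g).2 ⟨hinj, by simp⟩
  ext u w
  obtain ⟨i, rfl⟩ := hbij.2 u
  obtain ⟨j, rfl⟩ := hbij.2 w
  rw [SimpleGraph.top_adj]
  exact ⟨fun h => h.ne, fun h => hg fun hij => h (hij ▸ rfl)⟩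

theorem bRelaxed_top (V : Type) [Fintype V] : bRelaxed (⊤ : SimpleGraph V) = Fintype.card V :=
  le_antisymm (bRelaxed_le_card _) (le_bRelaxed_of_pairwise_adj (Fintype.equivFin V).symm
    fun _ _ h => by simpa using h)

theorem three_le_bRelaxed_iff_exists_isBAtom {V : Type} [Fintype V] (G : SimpleGraph V)
    (hV : Fintype.card V ≤ 5) :
    3 ≤ bRelaxed G ↔ ∃ s : Finset V, IsBAtom (G.induce (↑s : Set V)) 3 := by
  classical
  constructor
  · intro h
    obtain ⟨f, hf⟩ := (le_bRelaxed_iff G 3).1 h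
    let s : Finset V := Finset.univ.filter fun v => f v ≠ none
    obtain ⟨c, hsurj, hc, hb⟩ : HasBColoring (G.induce (↑s : Set V)) 3 :=
      hf.hasBColoring (by simp [s])
    choose g hg hb using hb
    refine ⟨s, fun i => Finset.univ.filter fun v => c v = i, g, ?_, ?_, ?_, ?_, ?_⟩
    · intro v
      exact ⟨c v, by simp, fun i hi => (Finset.mem_filter.1 hi).2.symm⟩
    · intro i
      simp [hg]
    · intro i u hu v hv huv
      simp only [Finset.mem_filter, Finset.mem_univ, true_and] at hu hv
      exact hc u v huv (hu.trans hv.symm)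
    · intro i
      have hsum := Finset.card_eq_sum_card_fiberwise (f := c) (s := Finset.univ)
        (t := Finset.univ) (fun _ _ => by simp)
      have hle : (Finset.univ : Finset (↑s : Set V)).card ≤ 5 := by
        rw [Finset.card_univ]
        exact (Fintype.card_subtype_le _).trans hV
      have hpos : ∀ j : Fin 3, 1 ≤ (Finset.univ.filter fun v => c v = j).card := fun j =>
        Finset.card_pos.2 ⟨g j, by simp [hg]⟩
      have h0 := hpos 0
      have h1 := hpos 1
      have h2 := hpos 2
      rw [Fin.sum_univ_three] at hsum
      fin_cases i <;> simp only [Fin.zero_eta, Fin.mk_one, Fin.reduceFinMk] <;> omega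
    · intro i j hij
      obtain ⟨u, hu, hcu⟩ := hb i j hij.symm
      exact ⟨u, by simp [hcu], hu⟩
  · rintro ⟨s, D, g, hD, hg, hind, -, hb⟩
    choose c hc hcuniq using hD
    have hcD : ∀ v i, v ∈ D i → c v = i := fun v i h => (hcuniq v i h).symm
    rw [le_bRelaxed_iff]
    refine HasBColoring.exists_isPartialBColoring (s := (↑s : Set V)) ⟨c, ?_, ?_, ?_⟩
    · exact fun i => ⟨g i, hcD _ _ (hg i)⟩
    · intro u v huv heq
      exact hind (c u) u (hc u) v (heq ▸ hc v) huv
    · intro i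
      refine ⟨g i, hcD _ _ (hg i), fun j hj => ?_⟩
      obtain ⟨u, hu, hadj⟩ := hb i j hj.symm
      exact ⟨u, hadj, hcD _ _ hu⟩

theorem two_le_bRelaxed_induce_ne_iff {V : Type} {G : SimpleGraph V} {v : V}
    [Fintype {u : V | u ≠ v}] :
    2 ≤ bRelaxed (G.induce {u : V | u ≠ v}) ↔ ∃ a b, G.Adj a b ∧ a ≠ v ∧ b ≠ v := by
  rw [two_le_bRelaxed_iff]
  constructor
  · rintro ⟨⟨a, ha⟩, ⟨b, hb⟩, h⟩
    exact ⟨a, b, h, ha, hb⟩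
  · rintro ⟨a, b, h, ha, hb⟩
    exact ⟨⟨a, ha⟩, ⟨b, hb⟩, h⟩

theorem three_le_bRelaxed_of_triangle {V : Type} [Fintype V] {G : SimpleGraph V} {a b c : V}
    (hab : G.Adj a b) (hac : G.Adj a c) (hbc : G.Adj b c) : 3 ≤ bRelaxed G := by
  refine le_bRelaxed_of_pairwise_adj ![a, b, c] ?_
  intro i j hij
  fin_cases i <;> fin_cases j <;> simp_all [G.adj_comm]

theorem four_le_bRelaxed_of_adj {V : Type} [Fintype V] {G : SimpleGraph V} {a b c d : V}
    (hab : G.Adj a b) (hac : G.Adj a c) (had : G.Adj a d) (hbc : G.Adj b c) (hbd : G.Adj b d)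
    (hcd : G.Adj c d) : 4 ≤ bRelaxed G := by
  refine le_bRelaxed_of_pairwise_adj ![a, b, c, d] ?_
  intro i j hij
  fin_cases i <;> fin_cases j <;> simp_all [G.adj_comm]

/-- If no vertex meets every edge, then there are two disjoint edges or a triangle. -/
theorem exists_disjoint_edges_of_forall_exists_adj_ne {V : Type} [Fintype V] [Nonempty V]
    {G : SimpleGraph V} (h : ∀ v, ∃ a b, G.Adj a b ∧ a ≠ v ∧ b ≠ v) (h3 : ¬ 3 ≤ bRelaxed G) :
    ∃ a b x y : V, G.Adj a b ∧ G.Adj x y ∧ a ≠ x ∧ a ≠ y ∧ b ≠ x ∧ b ≠ y := by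
  by_contra! hdis
  have key : ∀ a b, G.Adj a b → ∃ z, G.Adj b z ∧ z ≠ a := by
    intro a b hab
    obtain ⟨x, y, hxy, hxa, hya⟩ := h a
    by_cases hbx : b = x
    · exact ⟨y, hbx ▸ hxy, hya⟩
    · have := hdis a b x y hab hxy hxa.symm hya.symm hbx
      exact ⟨x, this ▸ hxy.symm, hxa⟩
  obtain ⟨a, b, hab, -, -⟩ := h (Classical.arbitrary V)
  obtain ⟨z, hbz, hza⟩ := key a b hab
  obtain ⟨w, haw, hwb⟩ := key b a hab.symm
  by_cases hzw : z = w
  · exact h3 (three_le_bRelaxed_of_triangle hab (hzw ▸ haw) hbz)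
  · exact hzw (hdis a w b z haw hbz hab.ne hza.symm hwb).symm

theorem triangle_of_forall_mem_five {V : Type} {G : SimpleGraph V} {v w x y z : V}
    (hall : ∀ u, u = v ∨ u = w ∨ u = x ∨ u = y ∨ u = z)
    (h : ∃ a b c, G.Adj a b ∧ G.Adj a c ∧ G.Adj b c ∧ a ≠ v ∧ b ≠ v ∧ c ≠ v) :
    (G.Adj w x ∧ G.Adj w y ∧ G.Adj x y) ∨ (G.Adj w x ∧ G.Adj w z ∧ G.Adj x z) ∨
      (G.Adj w y ∧ G.Adj w z ∧ G.Adj y z) ∨ (G.Adj x y ∧ G.Adj x z ∧ G.Adj y z) := by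
  obtain ⟨a, b, c, hab, hac, hbc, hav, hbv, hcv⟩ := h
  replace hav := (hall a).resolve_left hav
  replace hbv := (hall b).resolve_left hbv
  replace hcv := (hall c).resolve_left hcv
  clear hall
  rcases hav with rfl | rfl | rfl | rfl <;> rcases hbv with rfl | rfl | rfl | rfl <;>
    first
    | exact absurd rfl hab.ne
    | rcases hcv with rfl | rfl | rfl | rfl <;>
        first
        | exact absurd rfl hac.ne
        | exact absurd rfl hbc.ne
        | simp only [hab, hac, hbc, hab.symm, hac.symm, hbc.symm, true_and, true_or, or_true]

/-- On five vertices, triangles without a common vertex force a `K₄`. -/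
theorem four_le_bRelaxed_of_forall_triangle_ne {V : Type} [Fintype V] {G : SimpleGraph V}
    (hV : Fintype.card V = 5)
    (h : ∀ v, ∃ a b c, G.Adj a b ∧ G.Adj a c ∧ G.Adj b c ∧ a ≠ v ∧ b ≠ v ∧ c ≠ v) :
    4 ≤ bRelaxed G := by
  classical
  by_contra hK
  have k4 : ∀ a b c d, G.Adj a b → G.Adj a c → G.Adj a d → G.Adj b c → G.Adj b d →
      ¬ G.Adj c d := fun a b c d h1 h2 h3 h4 h5 h6 =>
    hK (four_le_bRelaxed_of_adj h1 h2 h3 h4 h5 h6)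
  let e := (Fintype.equivFinOfCardEq hV).symm
  have hall : ∀ u, u = e 0 ∨ u = e 1 ∨ u = e 2 ∨ u = e 3 ∨ u = e 4 := by
    intro u
    obtain ⟨i, rfl⟩ := e.surjective u
    fin_cases i <;> simp
  generalize e 0 = p, e 1 = q, e 2 = r, e 3 = s, e 4 = t at hall
  have h0 := triangle_of_forall_mem_five hall (h p)
  have h1 := triangle_of_forall_mem_five (G := G) (v := q) (w := p) (x := r) (y := s) (z := t)
    (fun u => by rcases hall u with h | h | h | h | h <;> simp [h]) (h q)
  have h2 := triangle_of_forall_mem_five (G := G) (v := r) (w := p) (x := q) (y := s) (z := t)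
    (fun u => by rcases hall u with h | h | h | h | h <;> simp [h]) (h r)
  have h3 := triangle_of_forall_mem_five (G := G) (v := s) (w := p) (x := q) (y := r) (z := t)
    (fun u => by rcases hall u with h | h | h | h | h <;> simp [h]) (h s)
  have h4 := triangle_of_forall_mem_five (G := G) (v := t) (w := p) (x := q) (y := r) (z := s)
    (fun u => by rcases hall u with h | h | h | h | h <;> simp [h]) (h t)
  have k0 := k4 q r s t
  have k1 := k4 p r s t
  have k2 := k4 p q s t
  have k3 := k4 p q r t
  have k5 := k4 p q r s
  clear h hall hK k4
  grind

theorem nonempty_iso_top_iff {V W : Type} [Fintype V] [Fintype W] (G : SimpleGraph V) :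
    Nonempty (G ≃g (⊤ : SimpleGraph W)) ↔ Fintype.card V = Fintype.card W ∧ G = ⊤ := by
  constructor
  · rintro ⟨e⟩
    refine ⟨Fintype.card_congr e.toEquiv, ?_⟩
    ext u w
    rw [← e.map_adj_iff, SimpleGraph.top_adj, SimpleGraph.top_adj, e.injective.ne_iff]
  · rintro ⟨h, rfl⟩
    exact ⟨SimpleGraph.Iso.completeGraph (Fintype.equivOfCardEq h)⟩

/-- Vertex deletions preserve `φ_r` in a graph with four or five vertices only if `φ_r ≤ 2`. -/
theorem bRelaxed_lt_three_of_forall_bRelaxed_induce_ne {V : Type} [Fintype V] [DecidableEq V]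
    {G : SimpleGraph V} (h4 : 4 ≤ Fintype.card V) (h5 : Fintype.card V ≤ 5)
    (h : ∀ v : V, bRelaxed (G.induce {u : V | u ≠ v}) = bRelaxed G) : bRelaxed G < 3 := by
  by_contra! h3
  have hcard : ∀ v : V, Fintype.card {u : V | u ≠ v} = Fintype.card V - 1 :=
    fun v => Set.card_ne_eq v
  have hne : Nonempty V := Fintype.card_pos_iff.1 (by omega)
  have hlt : bRelaxed G ≤ Fintype.card V - 1 := by
    have v := Classical.arbitrary V
    rw [← h v, ← hcard v]
    exact bRelaxed_le_card _
  rcases hlt.eq_or_lt with heq | hlt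
  · have htop : G = ⊤ := by
      ext a b
      refine ⟨fun hab => hab.ne, fun hab => ?_⟩
      obtain ⟨v, hv⟩ : ∃ v, v ∉ ({a, b} : Finset V) := by
        by_contra! hv
        have h1 : Fintype.card V ≤ ({a, b} : Finset V).card :=
          Finset.card_le_card fun x _ => hv x
        have h2 : ({a, b} : Finset V).card ≤ 2 := Finset.card_le_two
        omega
      simp only [Finset.mem_insert, Finset.mem_singleton, not_or] at hv
      have htop : G.induce {u : V | u ≠ v} = ⊤ :=
        eq_top_of_card_le_bRelaxed (by rw [hcard, h, heq])
      have : (G.induce {u : V | u ≠ v}).Adj ⟨a, Ne.symm hv.1⟩ ⟨b, Ne.symm hv.2⟩ := by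
        rw [htop, SimpleGraph.top_adj]
        simpa using hab
      exact this
    have := bRelaxed_top V
    rw [← htop] at this
    omega
  · have hR : bRelaxed G = 3 := by omega
    have := four_le_bRelaxed_of_forall_triangle_ne (G := G) (by omega) fun v => by
      obtain ⟨g, -, hg⟩ := exists_pairwise_adj_of_le_bRelaxed
        (G := G.induce {u : V | u ≠ v}) (k := 3) (by rw [h, hR]) (by rw [hcard]; omega)
      exact ⟨g 0, g 1, g 2, hg (by decide), hg (by decide), hg (by decide), (g 0).2, (g 1).2,
        (g 2).2⟩
    omega

theorem or_or_iff_exactly_one {A B C : Prop} (hAB : A → ¬ B) (hAC : A → ¬ C) (hBC : B → ¬ C) :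
    (A ∨ B ∨ C) ↔ (A ∧ ¬ B ∧ ¬ C) ∨ (¬ A ∧ B ∧ ¬ C) ∨ (¬ A ∧ ¬ B ∧ C) := by
  tauto

/-- for a graph G with at least 2 vertices,
φ_r(G-v) = φ_r(G) + ⌊|V(G)|/2⌋ - 2 for every vertex v iff exactly one of:
(i) G ≅ P₂ or G ≅ C₃; (ii) G has no edges and 4 ≤ |V(G)| ≤ 5;
(iii) 4 ≤ |V(G)| ≤ 5, G contains two disjoint edges, and G has no induced b-3-atom. -/
theorem bRelaxed_deleteVert_iff {V : Type} [Fintype V] [DecidableEq V] (G : SimpleGraph V)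
    (hV : 2 ≤ Fintype.card V) :
    (∀ v : V, bRelaxed (G.induce {u : V | u ≠ v}) =
        bRelaxed G + Fintype.card V / 2 - 2) ↔
      (let condI : Prop := Nonempty (G ≃g SimpleGraph.pathGraph 2) ∨
          Nonempty (G ≃g SimpleGraph.cycleGraph 3);
       let condII : Prop := (∀ u w : V, ¬ G.Adj u w) ∧
          4 ≤ Fintype.card V ∧ Fintype.card V ≤ 5;
       let condIII : Prop := 4 ≤ Fintype.card V ∧ Fintype.card V ≤ 5 ∧
          (∃ a b x y : V, G.Adj a b ∧ G.Adj x y ∧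
            a ≠ x ∧ a ≠ y ∧ b ≠ x ∧ b ≠ y) ∧
          ¬ ∃ s : Finset V, IsBAtom (G.induce (↑s : Set V)) 3;
       (condI ∧ ¬ condII ∧ ¬ condIII) ∨ (¬ condI ∧ condII ∧ ¬ condIII) ∨
         (¬ condI ∧ ¬ condII ∧ condIII)) := by
  extract_lets condI condII condIII
  have hI : condI ↔ (Fintype.card V = 2 ∨ Fintype.card V = 3) ∧ G = ⊤ := by
    simp only [condI, SimpleGraph.pathGraph_two_eq_top, SimpleGraph.cycleGraph_three_eq_top,
      nonempty_iso_top_iff, Fintype.card_fin, or_and_right]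
  have h12 : condI → ¬ condII := fun h h' => by
    have := (hI.1 h).1
    have := h'.2.1
    omega
  have h13 : condI → ¬ condIII := fun h h' => by
    have := (hI.1 h).1
    have := h'.1
    omega
  have h23 : condII → ¬ condIII := by
    rintro ⟨h, -⟩ ⟨-, -, ⟨a, b, -, -, hab, -⟩, -⟩
    exact h a b hab
  suffices hmain : (∀ v : V, bRelaxed (G.induce {u : V | u ≠ v}) =
      bRelaxed G + Fintype.card V / 2 - 2) ↔ condI ∨ condII ∨ condIII by
    exact hmain.trans (or_or_iff_exactly_one h12 h13 h23)
  have hne : Nonempty V := Fintype.card_pos_iff.1 (by omega)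
  have v₀ : V := Classical.arbitrary V
  have hcard : ∀ v : V, Fintype.card {u : V | u ≠ v} = Fintype.card V - 1 :=
    fun v => Set.card_ne_eq v
  have hnev : ∀ v : V, Nonempty {u : V | u ≠ v} := fun v =>
    Fintype.card_pos_iff.1 (by rw [hcard]; omega)
  have hpos : ∀ v : V, 1 ≤ bRelaxed (G.induce {u : V | u ≠ v}) := fun v => one_le_bRelaxed _
  have hle : ∀ v : V, bRelaxed (G.induce {u : V | u ≠ v}) ≤ bRelaxed G :=
    fun v => bRelaxed_induce_le G _
  have hlec : ∀ v : V, bRelaxed (G.induce {u : V | u ≠ v}) ≤ Fintype.card V - 1 := fun v => by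
    rw [← hcard v]
    exact bRelaxed_le_card _
  have hG1 : 1 ≤ bRelaxed G := one_le_bRelaxed G
  have hGle : bRelaxed G ≤ Fintype.card V := bRelaxed_le_card G
  constructor
  · intro h
    have h6 : Fintype.card V < 6 := by
      by_contra! h6
      have := h v₀
      have := hle v₀
      omega
    by_cases h4 : 4 ≤ Fintype.card V
    · have h' : ∀ v : V, bRelaxed (G.induce {u : V | u ≠ v}) = bRelaxed G := fun v => by
        have := h v
        omega
      have h3 := bRelaxed_lt_three_of_forall_bRelaxed_induce_ne h4 (by omega) h'
      right
      by_cases h2 : 2 ≤ bRelaxed G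
      · refine Or.inr ⟨h4, by omega, ?_, ?_⟩
        · refine exists_disjoint_edges_of_forall_exists_adj_ne (fun v => ?_) (by omega)
          exact two_le_bRelaxed_induce_ne_iff.1 ((h' v).symm ▸ h2)
        · rw [← three_le_bRelaxed_iff_exists_isBAtom G (by omega)]
          omega
      · rw [two_le_bRelaxed_iff] at h2
        push Not at h2
        exact Or.inl ⟨h2, h4, by omega⟩
    · left
      rw [hI]
      refine ⟨by omega, eq_top_of_card_le_bRelaxed ?_⟩
      have h0 := h v₀
      have h0' := hpos v₀
      by_contra! hlt
      obtain ⟨a, b, hab⟩ := (two_le_bRelaxed_iff G).1 (by omega)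
      obtain ⟨v, hv⟩ : ∃ v, v ∉ ({a, b} : Finset V) := by
        by_contra! hv
        have h1 : Fintype.card V ≤ ({a, b} : Finset V).card :=
          Finset.card_le_card fun x _ => hv x
        have h2 : ({a, b} : Finset V).card ≤ 2 := Finset.card_le_two
        omega
      simp only [Finset.mem_insert, Finset.mem_singleton, not_or] at hv
      have h1 := two_le_bRelaxed_induce_ne_iff.2 ⟨a, b, hab, Ne.symm hv.1, Ne.symm hv.2⟩
      have h2 := h v
      omega
  · rintro (h | ⟨h, h4, h5⟩ | ⟨h4, h5, ⟨a, b, x, y, hab, hxy, hax, hay, hbx, hby⟩, hA⟩) v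
    · obtain ⟨hn, htop⟩ := hI.1 h
      have hv : G.induce {u : V | u ≠ v} = ⊤ := by
        rw [htop]
        ext u w
        simp [Subtype.ext_iff]
      rw [hv, htop, bRelaxed_top, bRelaxed_top, hcard]
      omega
    · have h2 : ¬ 2 ≤ bRelaxed G := by
        rw [two_le_bRelaxed_iff]
        rintro ⟨u, w, huw⟩
        exact h u w huw
      have := hle v
      have := hpos v
      omega
    · have h3 : ¬ 3 ≤ bRelaxed G := by rwa [three_le_bRelaxed_iff_exists_isBAtom G h5]
      have h2 : 2 ≤ bRelaxed (G.induce {u : V | u ≠ v}) := by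
        rw [two_le_bRelaxed_induce_ne_iff]
        by_cases hv : a = v ∨ b = v
        · exact ⟨x, y, hxy, fun h => hv.elim (fun h' => hax (h'.trans h.symm))
              (fun h' => hbx (h'.trans h.symm)),
            fun h => hv.elim (fun h' => hay (h'.trans h.symm))
              (fun h' => hby (h'.trans h.symm))⟩
        · exact ⟨a, b, hab, fun h => hv (Or.inl h), fun h => hv (Or.inr h)⟩
      have := hle v
      omega
end
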